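/- arXiv:2011.12624 — 2 statements merged into one kernel-verified Lean document; each statement's English description precedes it below -/
import Mathlib

section
/- There exists a universal constant C > 0 such that at every point of B_1 with z ≠ 0 one has |F( Σ_{i,j=1}^N b_{ij} X_i X_j ρ )| ≤ C ψ, where the first-order operator F = (ρ/μ) Σ_{q,r=1}^N a_{qr} X_qρ X_r is applied to the function (z,t) ↦ Σ_{i,j=1}^N b_{ij}(z,t) (X_i X_j ρ)(z,t). -/
open MeasureTheory Real Set Filter Asymptotics

noncomputable section

/-- The underlying space ℝ^m × ℝ^k. -/
abbrev E (m k : ℕ) : Type :=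
  EuclideanSpace ℝ (Fin m) × EuclideanSpace ℝ (Fin k)

namespace BG

variable {m k : ℕ}

/-- The Baouendi–Grushin gauge ρ. -/
def rho (γ : ℝ) (p : E m k) : ℝ :=
  (‖p.1‖ ^ (2 * (γ + 1)) + (γ + 1) ^ 2 * ‖p.2‖ ^ 2) ^ (1 / (2 * (γ + 1)))

/-- The angle function ψ = |z|^{2γ}/ρ^{2γ}. -/
def psi (γ : ℝ) (p : E m k) : ℝ :=
  ‖p.1‖ ^ (2 * γ) / rho γ p ^ (2 * γ)

/-- The gauge ball B_r = {ρ < r}. -/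
def ball (γ r : ℝ) : Set (E m k) := {p | rho γ p < r}

/-- The Baouendi–Grushin vector fields as direction fields:
X_i = ∂_{z_i} for i < m, X_{m+j} = |z|^γ ∂_{t_j}. -/
def Xvec (γ : ℝ) (p : E m k) (i : Fin (m + k)) : E m k :=
  if h : (i : ℕ) < m then (EuclideanSpace.single ⟨(i : ℕ), h⟩ 1, 0)
  else (0, EuclideanSpace.single ⟨(i : ℕ) - m, by have := i.isLt; omega⟩ (‖p.1‖ ^ γ))

/-- Derivative along the i-th Baouendi–Grushin vector field. -/
def Xd (γ : ℝ) (i : Fin (m + k)) (f : E m k → ℝ) (p : E m k) : ℝ :=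
  fderiv ℝ f p (Xvec γ p i)

/-- The quadratic form ⟨A Xu, Xu⟩. -/
def quadA (γ : ℝ) (A : E m k → Matrix (Fin (m + k)) (Fin (m + k)) ℝ)
    (u : E m k → ℝ) (p : E m k) : ℝ :=
  ∑ i, ∑ j, A p i j * Xd γ i u p * Xd γ j u p

/-- μ = ⟨A Xρ, Xρ⟩. -/
def mu (γ : ℝ) (A : E m k → Matrix (Fin (m + k)) (Fin (m + k)) ℝ) (p : E m k) : ℝ :=
  quadA γ A (rho γ) p

/-- The operator 𝓛 u = Σ_{i,j} X_i(a_{ij} X_j u). -/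
def Lop (γ : ℝ) (A : E m k → Matrix (Fin (m + k)) (Fin (m + k)) ℝ)
    (u : E m k → ℝ) (p : E m k) : ℝ :=
  ∑ i, ∑ j, Xd γ i (fun q => A q i j * Xd γ j u q) p

/-- The vector field F = (ρ/μ) Σ a_{ij} X_iρ X_j, as a first order operator. -/
def Fop (γ : ℝ) (A : E m k → Matrix (Fin (m + k)) (Fin (m + k)) ℝ)
    (v : E m k → ℝ) (p : E m k) : ℝ :=
  rho γ p / mu γ A p * ∑ i, ∑ j, A p i j * Xd γ i (rho γ) p * Xd γ j v p

/-- The Baouendi–Grushin operator 𝓑_γ = Δ_z + |z|^{2γ} Δ_t = Σ_i X_i X_i. -/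
def Bop (γ : ℝ) (u : E m k → ℝ) (p : E m k) : ℝ :=
  ∑ i : Fin (m + k), Xd γ i (Xd γ i u) p

/-- The generator of anisotropic dilations Z = Σ z_i ∂_{z_i} + (γ+1) Σ t_j ∂_{t_j},
as a first order operator: the derivative in the direction (z, (γ+1) t). -/
def Zd (γ : ℝ) (v : E m k → ℝ) (p : E m k) : ℝ :=
  fderiv ℝ v p (p.1, (γ + 1) • p.2)

/-- The Euclidean divergence of a vector field on ℝ^m × ℝ^k. -/
def divV (V : E m k → E m k) (p : E m k) : ℝ :=
  (∑ i : Fin m, (fderiv ℝ V p (EuclideanSpace.single i 1, 0)).1 i) +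
    ∑ j : Fin k,
      (fderiv ℝ V p ((0 : EuclideanSpace ℝ (Fin m)), EuclideanSpace.single j 1)).2 j

/-- Uniform ellipticity: λ|η|² ≤ ⟨Aη,η⟩ ≤ λ⁻¹|η|². -/
def Elliptic (lam : ℝ) (A : E m k → Matrix (Fin (m + k)) (Fin (m + k)) ℝ) : Prop :=
  ∀ (p : E m k) (η : Fin (m + k) → ℝ),
    lam * ∑ i, η i ^ 2 ≤ ∑ i, ∑ j, A p i j * η i * η j ∧
      ∑ i, ∑ j, A p i j * η i * η j ≤ lam⁻¹ * ∑ i, η i ^ 2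

/-- Symmetry of the matrix A. -/
def Symm (A : E m k → Matrix (Fin (m + k)) (Fin (m + k)) ℝ) : Prop :=
  ∀ p i j, A p i j = A p j i

/-- The entries of A are C¹. -/
def C1coeff (A : E m k → Matrix (Fin (m + k)) (Fin (m + k)) ℝ) : Prop :=
  ∀ i j, ContDiff ℝ 1 fun p => A p i j

/-- The structural hypothesis (H) on B = A - I, in B_1. -/
def HypH (γ Λ : ℝ) (A : E m k → Matrix (Fin (m + k)) (Fin (m + k)) ℝ) : Prop :=
  ∀ p ∈ ball (m := m) (k := k) γ 1,
    (∀ i j : Fin (m + k),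
        |(A p - 1) i j| ≤
          if (i : ℕ) < m ∧ (j : ℕ) < m then Λ * rho γ p
          else Λ * psi γ p ^ ((1 : ℝ) / 2 + 1 / (2 * γ)) * rho γ p) ∧
      ∀ l i j : Fin (m + k),
        |Xd γ l (fun q => (A q - 1) i j) p| ≤
          if (l : ℕ) < m ∧ (i : ℕ) < m ∧ (j : ℕ) < m then Λ
          else if m ≤ (l : ℕ) ∧ (m ≤ (i : ℕ) ∨ m ≤ (j : ℕ)) then
            Λ * psi γ p ^ ((1 : ℝ) + 1 / (2 * γ))
          else Λ * psi γ p ^ ((1 : ℝ) / 2)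

end BG

namespace BG

variable {m k : ℕ}

lemma Xd_z (γ : ℝ) (i : Fin m) (f : E m k → ℝ) (p : E m k) :
    Xd γ (Fin.castAdd k i) f p = fderiv ℝ f p (EuclideanSpace.single i 1, 0) := by
  simp [Xd, Xvec]

lemma Xd_t (γ : ℝ) (j : Fin k) (f : E m k → ℝ) (p : E m k) :
    Xd γ (Fin.natAdd m j) f p = fderiv ℝ f p (0, EuclideanSpace.single j (‖p.1‖ ^ γ)) := by
  simp [Xd, Xvec]

/-- The inner sum defining rho. -/
def gsum (γ : ℝ) (p : E m k) : ℝ := ‖p.1‖ ^ (2 * (γ + 1)) + (γ + 1) ^ 2 * ‖p.2‖ ^ 2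

lemma gsum_pos (γ : ℝ) {p : E m k} (hp : p.1 ≠ 0) : 0 < gsum γ p := by
  have : 0 < ‖p.1‖ := norm_pos_iff.mpr hp
  unfold gsum; positivity

lemma rho_eq (γ : ℝ) (p : E m k) : rho γ p = gsum γ p ^ (1 / (2 * (γ + 1))) := rfl

lemma rho_pos (γ : ℝ) {p : E m k} (hp : p.1 ≠ 0) : 0 < rho γ p := by
  rw [rho_eq]; exact Real.rpow_pos_of_pos (gsum_pos γ hp) _

lemma rho_rpow (γ b : ℝ) {p : E m k} (hp : p.1 ≠ 0) :
    rho γ p ^ b = gsum γ p ^ (b / (2 * (γ + 1))) := by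
  rw [rho_eq, ← Real.rpow_mul (gsum_pos γ hp).le]; congr 1; ring

lemma rho_rpow_two {γ : ℝ} (hγ : 0 < γ) {p : E m k} (hp : p.1 ≠ 0) :
    rho γ p ^ (2 * (γ + 1)) = gsum γ p := by
  rw [rho_rpow γ _ hp, div_self (by positivity), Real.rpow_one]

lemma norm_le_rho {γ : ℝ} (hγ : 0 < γ) {p : E m k} (hp : p.1 ≠ 0) : ‖p.1‖ ≤ rho γ p := by
  have h := rho_rpow_two hγ hp
  have h1 : ‖p.1‖ ^ (2 * (γ + 1)) ≤ rho γ p ^ (2 * (γ + 1)) := by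
    rw [h]; unfold gsum; nlinarith [sq_nonneg ((γ + 1) * ‖p.2‖)]
  exact (Real.rpow_le_rpow_iff (norm_nonneg _) (rho_pos γ hp).le (by positivity)).1 h1

lemma t_le_rho {γ : ℝ} (hγ : 0 < γ) {p : E m k} (hp : p.1 ≠ 0) :
    ‖p.2‖ ≤ rho γ p ^ (γ + 1) := by
  have h := rho_rpow_two hγ hp
  have hr := rho_pos γ hp
  have h2 : (rho γ p ^ (γ + 1)) ^ 2 = gsum γ p := by
    rw [← h, ← Real.rpow_natCast, ← Real.rpow_mul hr.le]; congr 1; push_cast; ring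
  have h3 : ‖p.2‖ ^ 2 ≤ (rho γ p ^ (γ + 1)) ^ 2 := by
    rw [h2]; unfold gsum
    have : 0 ≤ ‖p.1‖ ^ (2 * (γ + 1)) := by positivity
    nlinarith [sq_nonneg (‖p.2‖), mul_nonneg hγ.le (sq_nonneg ‖p.2‖),
      mul_nonneg (mul_nonneg hγ.le hγ.le) (sq_nonneg ‖p.2‖)]
  exact (sq_le_sq₀ (norm_nonneg _) (by positivity)).1 h3

/-- The ratio |z| / rho. -/
def sg (γ : ℝ) (p : E m k) : ℝ := ‖p.1‖ / rho γ p

lemma sg_pos (γ : ℝ) {p : E m k} (hp : p.1 ≠ 0) : 0 < sg γ p :=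
  div_pos (norm_pos_iff.mpr hp) (rho_pos γ hp)

lemma sg_le {γ : ℝ} (hγ : 0 < γ) {p : E m k} (hp : p.1 ≠ 0) : sg γ p ≤ 1 :=
  (div_le_one (rho_pos γ hp)).2 (norm_le_rho hγ hp)

lemma norm_eq (γ : ℝ) {p : E m k} (hp : p.1 ≠ 0) : ‖p.1‖ = sg γ p * rho γ p := by
  unfold sg; rw [div_mul_cancel₀ _ (rho_pos γ hp).ne']

lemma psi_rpow (γ e : ℝ) {p : E m k} (hp : p.1 ≠ 0) :
    psi γ p ^ e = sg γ p ^ (2 * γ * e) := by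
  rw [Real.rpow_mul (sg_pos γ hp).le]; unfold psi sg
  rw [Real.div_rpow (norm_nonneg _) (rho_pos γ hp).le]

lemma psi_eq (γ : ℝ) {p : E m k} (hp : p.1 ≠ 0) : psi γ p = sg γ p ^ (2 * γ) := by
  have := psi_rpow γ 1 hp
  simpa using this

/-! Derivatives of the generators. -/

lemma hasFDerivAt_spow (a : ℝ) {p : E m k} (hp : p.1 ≠ 0) :
    HasFDerivAt (fun q : E m k => ‖q.1‖ ^ a)
      ((a * ‖p.1‖ ^ (a - 2)) • ((innerSL ℝ p.1).comp (ContinuousLinearMap.fst ℝ _ _))) p := by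
  have hs : 0 < ‖p.1‖ := norm_pos_iff.mpr hp
  have h1 : HasFDerivAt (fun q : E m k => ‖q.1‖ ^ 2)
      (2 • ((innerSL ℝ p.1).comp (ContinuousLinearMap.fst ℝ _ _))) p := by
    have := (hasFDerivAt_fst (𝕜 := ℝ) (p := p)).norm_sq
    exact this
  have h2 := h1.rpow_const (p := a / 2) (Or.inl (by positivity))
  have h3 : (fun q : E m k => ‖q.1‖ ^ a) = fun q : E m k => (‖q.1‖ ^ 2) ^ (a / 2) := by
    funext q
    rw [← Real.rpow_natCast, ← Real.rpow_mul (norm_nonneg _)]; congr 1; push_cast; ring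
  rw [h3]
  refine h2.congr_fderiv ?_
  have h4 : (‖p.1‖ ^ 2) ^ (a / 2 - 1) = ‖p.1‖ ^ (a - 2) := by
    rw [← Real.rpow_natCast, ← Real.rpow_mul (norm_nonneg _)]; congr 1; push_cast; ring
  rw [h4]
  ext v <;> simp <;> ring

lemma hasFDerivAt_gsum {γ : ℝ} (hγ : 0 < γ) {p : E m k} (hp : p.1 ≠ 0) :
    HasFDerivAt (gsum γ : E m k → ℝ)
      ((2 * (γ + 1) * ‖p.1‖ ^ (2 * γ)) • ((innerSL ℝ p.1).comp (ContinuousLinearMap.fst ℝ _ _))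
        + (γ + 1) ^ 2 • (2 • ((innerSL ℝ p.2).comp (ContinuousLinearMap.snd ℝ _ _)))) p := by
  have h1 := hasFDerivAt_spow (2 * (γ + 1)) hp
  have h2 : HasFDerivAt (fun q : E m k => ‖q.2‖ ^ 2)
      (2 • ((innerSL ℝ p.2).comp (ContinuousLinearMap.snd ℝ _ _))) p :=
    (hasFDerivAt_snd (𝕜 := ℝ) (p := p)).norm_sq
  have h3 := h1.add (h2.const_mul ((γ + 1) ^ 2))
  have e : 2 * (γ + 1) - 2 = 2 * γ := by ring
  rw [e] at h3
  exact h3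

lemma isOpen_U : IsOpen {p : E m k | p.1 ≠ 0} :=
  isOpen_ne_fun continuous_fst continuous_const

lemma U_nhds {p : E m k} (hp : p.1 ≠ 0) : {p : E m k | p.1 ≠ 0} ∈ nhds p :=
  isOpen_U.mem_nhds hp

lemma hasFDerivAt_rpow {γ : ℝ} (hγ : 0 < γ) (b : ℝ) {p : E m k} (hp : p.1 ≠ 0) :
    HasFDerivAt (fun q : E m k => rho γ q ^ b)
      ((b * ‖p.1‖ ^ (2 * γ) * rho γ p ^ (b - 2 * γ - 2)) •
          ((innerSL ℝ p.1).comp (ContinuousLinearMap.fst ℝ _ _))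
        + (b * (γ + 1) * rho γ p ^ (b - 2 * γ - 2)) •
          ((innerSL ℝ p.2).comp (ContinuousLinearMap.snd ℝ _ _))) p := by
  have h1 := (hasFDerivAt_gsum hγ hp).rpow_const (p := b / (2 * (γ + 1)))
    (Or.inl (gsum_pos γ hp).ne')
  have h2 : (fun q : E m k => rho γ q ^ b) =ᶠ[nhds p]
      fun q => gsum γ q ^ (b / (2 * (γ + 1))) := by
    filter_upwards [U_nhds hp] with q hq using rho_rpow γ b hq
  refine HasFDerivAt.congr_of_eventuallyEq ?_ h2
  refine h1.congr_fderiv ?_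
  have h4 : gsum γ p ^ (b / (2 * (γ + 1)) - 1) = rho γ p ^ (b - 2 * γ - 2) := by
    rw [rho_rpow γ _ hp]; congr 1; field_simp; ring
  rw [h4]
  ext v <;> simp <;> field_simp

lemma hasFDerivAt_rho {γ : ℝ} (hγ : 0 < γ) {p : E m k} (hp : p.1 ≠ 0) :
    HasFDerivAt (rho γ : E m k → ℝ)
      ((‖p.1‖ ^ (2 * γ) * rho γ p ^ (-1 - 2 * γ)) •
          ((innerSL ℝ p.1).comp (ContinuousLinearMap.fst ℝ _ _))
        + ((γ + 1) * rho γ p ^ (-1 - 2 * γ)) •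
          ((innerSL ℝ p.2).comp (ContinuousLinearMap.snd ℝ _ _))) p := by
  have h := hasFDerivAt_rpow hγ 1 hp
  simp only [Real.rpow_one, one_mul] at h
  have e : (1 : ℝ) - 2 * γ - 2 = -1 - 2 * γ := by ring
  rw [e] at h
  exact h

lemma Xz_spow (γ a : ℝ) (i : Fin m) {p : E m k} (hp : p.1 ≠ 0) :
    Xd γ (Fin.castAdd k i) (fun q : E m k => ‖q.1‖ ^ a) p
      = a * (‖p.1‖ ^ (a - 2) * p.1 i) := by
  rw [Xd_z, (hasFDerivAt_spow a hp).fderiv]; simp [PiLp.inner_apply]; ring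

lemma Xt_spow (γ a : ℝ) (j : Fin k) {p : E m k} (hp : p.1 ≠ 0) :
    Xd γ (Fin.natAdd m j) (fun q : E m k => ‖q.1‖ ^ a) p = 0 := by
  rw [Xd_t, (hasFDerivAt_spow a hp).fderiv]; simp

lemma Xz_rpow {γ : ℝ} (hγ : 0 < γ) (b : ℝ) (i : Fin m) {p : E m k} (hp : p.1 ≠ 0) :
    Xd γ (Fin.castAdd k i) (fun q : E m k => rho γ q ^ b) p
      = b * (‖p.1‖ ^ (2 * γ) * p.1 i * rho γ p ^ (b - 2 * γ - 2)) := by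
  rw [Xd_z, (hasFDerivAt_rpow hγ b hp).fderiv]; simp [PiLp.inner_apply]; ring

lemma Xt_rpow {γ : ℝ} (hγ : 0 < γ) (b : ℝ) (j : Fin k) {p : E m k} (hp : p.1 ≠ 0) :
    Xd γ (Fin.natAdd m j) (fun q : E m k => rho γ q ^ b) p
      = (b * (γ + 1)) * (‖p.1‖ ^ γ * p.2 j * rho γ p ^ (b - 2 * γ - 2)) := by
  rw [Xd_t, (hasFDerivAt_rpow hγ b hp).fderiv]; simp [PiLp.inner_apply]; ring

lemma Xz_rho {γ : ℝ} (hγ : 0 < γ) (i : Fin m) {p : E m k} (hp : p.1 ≠ 0) :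
    Xd γ (Fin.castAdd k i) (rho γ) p
      = ‖p.1‖ ^ (2 * γ) * p.1 i * rho γ p ^ (-1 - 2 * γ) := by
  rw [Xd_z, (hasFDerivAt_rho hγ hp).fderiv]; simp [PiLp.inner_apply]; ring

lemma Xt_rho {γ : ℝ} (hγ : 0 < γ) (j : Fin k) {p : E m k} (hp : p.1 ≠ 0) :
    Xd γ (Fin.natAdd m j) (rho γ) p
      = (γ + 1) * (‖p.1‖ ^ γ * p.2 j * rho γ p ^ (-1 - 2 * γ)) := by
  rw [Xd_t, (hasFDerivAt_rho hγ hp).fderiv]; simp [PiLp.inner_apply]; ring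

lemma sum_sq_rho {γ : ℝ} (hγ : 0 < γ) {p : E m k} (hp : p.1 ≠ 0) :
    ∑ i, Xd γ i (rho γ) p ^ 2 = psi γ p := by
  have hs : 0 < ‖p.1‖ := norm_pos_iff.mpr hp
  have hr := rho_pos γ hp
  rw [Fin.sum_univ_add]
  simp only [Xz_rho hγ _ hp, Xt_rho hγ _ hp, mul_pow]
  rw [← Finset.mul_sum, ← Finset.sum_mul, ← Finset.sum_mul, ← Finset.mul_sum, ← Finset.mul_sum]
  have e1 : ∑ i, p.1 i ^ 2 = ‖p.1‖ ^ 2 := by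
    rw [EuclideanSpace.norm_sq_eq]; simp
  have e2 : ∑ i, p.2 i ^ 2 = ‖p.2‖ ^ 2 := by
    rw [EuclideanSpace.norm_sq_eq]; simp
  rw [e1, e2]
  have h := rho_rpow_two hγ hp
  unfold gsum at h
  have h1 : ‖p.1‖ ^ (2 * (γ + 1)) = ‖p.1‖ ^ (2 * γ) * ‖p.1‖ ^ 2 := by
    rw [← Real.rpow_natCast, ← Real.rpow_add hs]; congr 1; push_cast; ring
  have h2 : ‖p.1‖ ^ (2 * γ) = (‖p.1‖ ^ γ) ^ 2 := by
    rw [← Real.rpow_natCast, ← Real.rpow_mul hs.le]; congr 1; push_cast; ring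
  have h3 : (rho γ p ^ (-1 - 2 * γ)) ^ 2 * rho γ p ^ (2 * (γ + 1)) * rho γ p ^ (2 * γ) = 1 := by
    rw [← Real.rpow_natCast, ← Real.rpow_mul hr.le, ← Real.rpow_add hr, ← Real.rpow_add hr]
    rw [← Real.rpow_zero (rho γ p)]; congr 1; push_cast; ring
  unfold psi
  rw [eq_div_iff (by positivity)]
  rw [h1] at h
  calc _ = (‖p.1‖ ^ (2 * γ)) * ((rho γ p ^ (-1 - 2 * γ)) ^ 2 *
        (‖p.1‖ ^ (2 * γ) * ‖p.1‖ ^ 2 + (γ + 1) ^ 2 * ‖p.2‖ ^ 2) * rho γ p ^ (2 * γ)) := by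
        rw [h2]; ring
    _ = _ := by rw [← h, h3, mul_one]

end BG
namespace BG

variable {m k : ℕ}

/-- Symbol-type bound of order (α, β). -/
def Bd (γ α β : ℝ) (f : E m k → ℝ) : Prop :=
  ∃ C, 0 ≤ C ∧ ∀ p : E m k, p.1 ≠ 0 → |f p| ≤ C * (sg γ p ^ α * rho γ p ^ β)

/-- Symbol class with control of n derivatives. -/
def KK (γ : ℝ) : ℕ → ℝ → ℝ → (E m k → ℝ) → Prop
  | 0, α, β, f => Bd γ α β f
  | n + 1, α, β, f => Bd γ α β f ∧ (∀ p : E m k, p.1 ≠ 0 → DifferentiableAt ℝ f p) ∧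
      (∀ i : Fin m, KK γ n (α - 1) (β - 1) (Xd γ (Fin.castAdd k i) f)) ∧
      ∀ j : Fin k, KK γ n (α + γ) (β - 1) (Xd γ (Fin.natAdd m j) f)

lemma KK.bd {γ : ℝ} {n : ℕ} {α β : ℝ} {f : E m k → ℝ} (h : KK γ n α β f) : Bd γ α β f := by
  cases n with
  | zero => exact h
  | succ n => exact h.1

lemma Bd.congr {γ α β : ℝ} {f g : E m k → ℝ} (h : Bd γ α β f)
    (hfg : ∀ p : E m k, p.1 ≠ 0 → g p = f p) : Bd γ α β g := by
  obtain ⟨C, hC, h⟩ := h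
  exact ⟨C, hC, fun p hp => by rw [hfg p hp]; exact h p hp⟩

lemma ev_eq {f g : E m k → ℝ} (hfg : ∀ p : E m k, p.1 ≠ 0 → g p = f p)
    {p : E m k} (hp : p.1 ≠ 0) : g =ᶠ[nhds p] f := by
  filter_upwards [U_nhds hp] with q hq using hfg q hq

lemma Xd_congr (γ : ℝ) {f g : E m k → ℝ} (hfg : ∀ p : E m k, p.1 ≠ 0 → g p = f p)
    (i : Fin (m + k)) {p : E m k} (hp : p.1 ≠ 0) : Xd γ i g p = Xd γ i f p := by
  unfold Xd; rw [(ev_eq hfg hp).fderiv_eq]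

lemma KK.congr {γ : ℝ} {n : ℕ} {α β : ℝ} {f g : E m k → ℝ} (h : KK γ n α β f)
    (hfg : ∀ p : E m k, p.1 ≠ 0 → g p = f p) : KK γ n α β g := by
  induction n generalizing α β f g with
  | zero => exact Bd.congr h hfg
  | succ n ih =>
    obtain ⟨h1, h2, h3, h4⟩ := h
    exact ⟨h1.congr hfg, fun p hp => (h2 p hp).congr_of_eventuallyEq (ev_eq hfg hp),
      fun i => ih (h3 i) fun p hp => Xd_congr γ hfg _ hp,
      fun i => ih (h4 i) fun p hp => Xd_congr γ hfg _ hp⟩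

lemma KK.mono {γ : ℝ} (hγ : 0 < γ) {n : ℕ} {α α' β : ℝ} {f : E m k → ℝ} (h : KK γ n α β f)
    (hα : α' ≤ α) : KK γ n α' β f := by
  have key : ∀ {α α' β : ℝ} {f : E m k → ℝ}, Bd γ α β f → α' ≤ α → Bd γ α' β f := by
    rintro α α' β f ⟨C, hC, h⟩ hα
    refine ⟨C, hC, fun p hp => (h p hp).trans ?_⟩
    have hr := rho_pos γ hp
    have := Real.rpow_le_rpow_of_exponent_ge (sg_pos γ hp) (sg_le hγ hp) hα
    gcongr
  induction n generalizing α α' β f with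
  | zero => exact key h hα
  | succ n ih =>
    obtain ⟨h1, h2, h3, h4⟩ := h
    exact ⟨key h1 hα, h2, fun i => ih (h3 i) (by linarith), fun i => ih (h4 i) (by linarith)⟩

lemma KK.down {γ : ℝ} {n : ℕ} {α β : ℝ} {f : E m k → ℝ} (h : KK γ (n + 1) α β f) :
    KK γ n α β f := by
  induction n generalizing α β f with
  | zero => exact h.1
  | succ n ih =>
    obtain ⟨h1, h2, h3, h4⟩ := h
    exact ⟨h1, h2, fun i => ih (h3 i), fun i => ih (h4 i)⟩

lemma KK.cast {γ : ℝ} {n : ℕ} {α β α' β' : ℝ} {f : E m k → ℝ} (h : KK γ n α β f)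
    (h1 : α = α') (h2 : β = β') : KK γ n α' β' f := by subst h1 h2; exact h

lemma KK.add {γ : ℝ} {n : ℕ} {α β : ℝ} {f g : E m k → ℝ} (hf : KK γ n α β f)
    (hg : KK γ n α β g) : KK γ n α β (fun p => f p + g p) := by
  have key : ∀ {α β : ℝ} {f g : E m k → ℝ}, Bd γ α β f → Bd γ α β g →
      Bd γ α β (fun p => f p + g p) := by
    rintro α β f g ⟨C, hC, h⟩ ⟨D, hD, h'⟩
    refine ⟨C + D, by positivity, fun p hp => (abs_add_le _ _).trans ?_⟩
    rw [add_mul]; exact add_le_add (h p hp) (h' p hp)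
  induction n generalizing α β f g with
  | zero => exact key hf hg
  | succ n ih =>
    obtain ⟨h1, h2, h3, h4⟩ := hf
    obtain ⟨k1, k2, k3, k4⟩ := hg
    have e : ∀ i (p : E m k), p.1 ≠ 0 → Xd γ i (fun p => f p + g p) p =
        Xd γ i f p + Xd γ i g p := by
      intro i p hp
      unfold Xd; rw [fderiv_fun_add (h2 p hp) (k2 p hp)]; rfl
    exact ⟨key h1 k1, fun p hp => (h2 p hp).add (k2 p hp),
      fun i => (ih (h3 i) (k3 i)).congr (e _), fun i => (ih (h4 i) (k4 i)).congr (e _)⟩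

lemma Bd.mul {γ α β α' β' : ℝ} {f g : E m k → ℝ} (hf : Bd γ α β f) (hg : Bd γ α' β' g) :
    Bd γ (α + α') (β + β') (fun p => f p * g p) := by
  obtain ⟨C, hC, h⟩ := hf
  obtain ⟨D, hD, h'⟩ := hg
  refine ⟨C * D, by positivity, fun p hp => ?_⟩
  rw [abs_mul, Real.rpow_add (sg_pos γ hp), Real.rpow_add (rho_pos γ hp)]
  have := mul_le_mul (h p hp) (h' p hp) (abs_nonneg _) ((abs_nonneg _).trans (h p hp))
  refine this.trans_eq (by ring)

lemma KK.mul {γ : ℝ} {n : ℕ} {α β α' β' : ℝ} {f g : E m k → ℝ} (hf : KK γ n α β f)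
    (hg : KK γ n α' β' g) : KK γ n (α + α') (β + β') (fun p => f p * g p) := by
  induction n generalizing α β α' β' f g with
  | zero => exact Bd.mul hf hg
  | succ n ih =>
    have hf' := hf.down
    have hg' := hg.down
    obtain ⟨h1, h2, h3, h4⟩ := hf
    obtain ⟨k1, k2, k3, k4⟩ := hg
    have e : ∀ i (p : E m k), p.1 ≠ 0 → Xd γ i (fun p => f p * g p) p =
        f p * Xd γ i g p + Xd γ i f p * g p := by
      intro i p hp
      unfold Xd; rw [fderiv_fun_mul (h2 p hp) (k2 p hp)]; simp; ring
    refine ⟨Bd.mul h1 k1, fun p hp => (h2 p hp).mul (k2 p hp), fun i => ?_, fun i => ?_⟩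
    · exact (((ih hf' (k3 i)).cast (by ring) (by ring)).add
        ((ih (h3 i) hg').cast (by ring) (by ring))).congr (e _)
    · exact (((ih hf' (k4 i)).cast (by ring) (by ring)).add
        ((ih (h4 i) hg').cast (by ring) (by ring))).congr (e _)

lemma KK_zero (γ : ℝ) (n : ℕ) (α β : ℝ) : KK γ n α β (fun _ : E m k => (0 : ℝ)) := by
  have key : ∀ α β : ℝ, Bd γ α β (fun _ : E m k => (0 : ℝ)) := fun α β =>
    ⟨0, le_rfl, fun p hp => by simp⟩
  induction n generalizing α β with
  | zero => exact key _ _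
  | succ n ih =>
    have e : ∀ i (p : E m k), p.1 ≠ 0 → Xd γ i (fun _ : E m k => (0 : ℝ)) p = 0 := by
      intro i p hp; simp [Xd]
    exact ⟨key _ _, fun p hp => differentiableAt_const _, fun i => (ih _ _).congr (e _),
      fun i => (ih _ _).congr (e _)⟩

lemma KK_const (γ : ℝ) (n : ℕ) (c : ℝ) : KK γ n 0 0 (fun _ : E m k => c) := by
  have key : Bd γ 0 0 (fun _ : E m k => c) := ⟨|c|, abs_nonneg _, fun p hp => by simp⟩
  cases n with
  | zero => exact key
  | succ n =>
    have e : ∀ i (p : E m k), p.1 ≠ 0 → Xd γ i (fun _ : E m k => c) p = 0 := by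
      intro i p hp; simp [Xd]
    exact ⟨key, fun p hp => differentiableAt_const _, fun i => (KK_zero _ _ _ _).congr (e _),
      fun i => (KK_zero _ _ _ _).congr (e _)⟩

lemma KK.const_mul {γ : ℝ} {n : ℕ} {α β : ℝ} {f : E m k → ℝ} (hf : KK γ n α β f) (c : ℝ) :
    KK γ n α β (fun p => c * f p) :=
  ((KK_const γ n c).mul hf).cast (by ring) (by ring)

lemma hasFDerivAt_zi (i : Fin m) (p : E m k) : HasFDerivAt (fun q : E m k => q.1 i)
    ((EuclideanSpace.proj i : EuclideanSpace ℝ (Fin m) →L[ℝ] ℝ).comp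
      (ContinuousLinearMap.fst ℝ _ _)) p :=
  ((EuclideanSpace.proj i : EuclideanSpace ℝ (Fin m) →L[ℝ] ℝ).comp
      (ContinuousLinearMap.fst ℝ _ (EuclideanSpace ℝ (Fin k)))).hasFDerivAt

lemma hasFDerivAt_tj (j : Fin k) (p : E m k) : HasFDerivAt (fun q : E m k => q.2 j)
    ((EuclideanSpace.proj j : EuclideanSpace ℝ (Fin k) →L[ℝ] ℝ).comp
      (ContinuousLinearMap.snd ℝ _ _)) p :=
  ((EuclideanSpace.proj j : EuclideanSpace ℝ (Fin k) →L[ℝ] ℝ).comp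
      (ContinuousLinearMap.snd ℝ (EuclideanSpace ℝ (Fin m)) _)).hasFDerivAt

lemma KK_z (γ : ℝ) (n : ℕ) (i : Fin m) : KK γ n 1 1 (fun q : E m k => q.1 i) := by
  have key : Bd γ 1 1 (fun q : E m k => q.1 i) := by
    refine ⟨1, zero_le_one, fun p hp => ?_⟩
    rw [Real.rpow_one, Real.rpow_one, one_mul, ← norm_eq γ hp]
    exact PiLp.norm_apply_le p.1 i
  cases n with
  | zero => exact key
  | succ n =>
    refine ⟨key, fun p hp => (hasFDerivAt_zi i p).differentiableAt, fun l => ?_, fun l => ?_⟩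
    · refine ((KK_const γ n ((EuclideanSpace.single l (1 : ℝ)) i)).congr fun p hp => ?_).cast
        (by ring) (by ring)
      rw [Xd_z, (hasFDerivAt_zi i p).fderiv]; rfl
    · refine (KK_zero γ n _ _).congr fun p hp => ?_
      rw [Xd_t, (hasFDerivAt_zi i p).fderiv]; simp

lemma KK_spow {γ : ℝ} (n : ℕ) (a : ℝ) : KK γ n a a (fun q : E m k => ‖q.1‖ ^ a) := by
  have key : ∀ a, Bd γ a a (fun q : E m k => ‖q.1‖ ^ a) := by
    intro a
    refine ⟨1, zero_le_one, fun p hp => ?_⟩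
    rw [← Real.mul_rpow (sg_pos γ hp).le (rho_pos γ hp).le, ← norm_eq γ hp, one_mul]
    rw [abs_of_nonneg (by positivity)]
  induction n generalizing a with
  | zero => exact key a
  | succ n ih =>
    refine ⟨key a, fun p hp => (hasFDerivAt_spow a hp).differentiableAt, fun l => ?_, fun l => ?_⟩
    · exact ((((ih (a - 2)).mul (KK_z γ n l)).const_mul a).congr
        fun p hp => Xz_spow γ a l hp).cast (by ring) (by ring)
    · exact (KK_zero γ n _ _).congr fun p hp => Xt_spow γ a l hp

lemma KK_t {γ : ℝ} (hγ : 0 < γ) (n : ℕ) (j : Fin k) :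
    KK γ n 0 (γ + 1) (fun q : E m k => q.2 j) := by
  have key : Bd γ 0 (γ + 1) (fun q : E m k => q.2 j) := by
    refine ⟨1, zero_le_one, fun p hp => ?_⟩
    rw [Real.rpow_zero, one_mul, one_mul]
    exact (PiLp.norm_apply_le p.2 j).trans (t_le_rho hγ hp)
  cases n with
  | zero => exact key
  | succ n =>
    refine ⟨key, fun p hp => (hasFDerivAt_tj j p).differentiableAt, fun l => ?_, fun l => ?_⟩
    · refine (KK_zero γ n _ _).congr fun p hp => ?_
      rw [Xd_z, (hasFDerivAt_tj j p).fderiv]; simp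
    · refine (((KK_spow n γ).const_mul (if j = l then 1 else 0)).congr fun p hp => ?_).cast
        (by ring) (by ring)
      rw [Xd_t, (hasFDerivAt_tj j p).fderiv]
      simp [Pi.single_apply]

lemma KK_rpow {γ : ℝ} (hγ : 0 < γ) (n : ℕ) (b : ℝ) :
    KK γ n 0 b (fun q : E m k => rho γ q ^ b) := by
  have key : ∀ b, Bd γ 0 b (fun q : E m k => rho γ q ^ b) := by
    intro b
    refine ⟨1, zero_le_one, fun p hp => ?_⟩
    have := rho_pos γ hp
    rw [Real.rpow_zero, one_mul, one_mul, abs_of_nonneg (by positivity)]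
  induction n generalizing b with
  | zero => exact key b
  | succ n ih =>
    refine ⟨key b, fun p hp => (hasFDerivAt_rpow hγ b hp).differentiableAt,
      fun l => ?_, fun l => ?_⟩
    · refine KK.mono hγ (α := 2 * γ + 1) ?_ (by linarith)
      exact (((((KK_spow n (2 * γ)).mul (KK_z γ n l)).mul (ih (b - 2 * γ - 2))).const_mul b).congr
        fun p hp => Xz_rpow hγ b l hp).cast (by ring) (by ring)
    · exact (((((KK_spow n γ).mul (KK_t hγ n l)).mul
        (ih (b - 2 * γ - 2))).const_mul (b * (γ + 1))).congr
        fun p hp => Xt_rpow hγ b l hp).cast (by ring) (by ring)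

lemma KK_Xz_rho {γ : ℝ} (hγ : 0 < γ) (n : ℕ) (i : Fin m) :
    KK γ n (2 * γ + 1) 0 (Xd γ (Fin.castAdd k i) (rho γ) : E m k → ℝ) :=
  ((((KK_spow n (2 * γ)).mul (KK_z γ n i)).mul (KK_rpow hγ n (-1 - 2 * γ))).congr
    fun _ hp => Xz_rho hγ i hp).cast (by ring) (by ring)

lemma KK_Xt_rho {γ : ℝ} (hγ : 0 < γ) (n : ℕ) (j : Fin k) :
    KK γ n γ 0 (Xd γ (Fin.natAdd m j) (rho γ) : E m k → ℝ) :=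
  (((((KK_spow n γ).mul (KK_t hγ n j)).mul (KK_rpow hγ n (-1 - 2 * γ))).const_mul (γ + 1)).congr
    fun _ hp => Xt_rho hγ j hp).cast (by ring) (by ring)

/-- Exponent of the first derivatives of rho. -/
def e1 (m k : ℕ) (γ : ℝ) (i : Fin (m + k)) : ℝ := if (i : ℕ) < m then 2 * γ + 1 else γ

/-- Exponent of the second derivatives of rho. -/
def e2 (m k : ℕ) (γ : ℝ) (i j : Fin (m + k)) : ℝ :=
  if (i : ℕ) < m ∧ (j : ℕ) < m then 2 * γ else γ - 1

/-- Exponent gained by a derivative. -/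
def ed (m k : ℕ) (γ : ℝ) (r : Fin (m + k)) : ℝ := if (r : ℕ) < m then -1 else γ

lemma KK_X1 {γ : ℝ} (hγ : 0 < γ) (n : ℕ) (i : Fin (m + k)) :
    KK γ n (e1 m k γ i) 0 (Xd γ i (rho γ) : E m k → ℝ) := by
  induction i using Fin.addCases with
  | left i => simpa [e1] using KK_Xz_rho hγ n i
  | right j => simpa [e1] using KK_Xt_rho hγ n j

lemma KK_X2 {γ : ℝ} (hγ : 0 < γ) (n : ℕ) (i j : Fin (m + k)) :
    KK γ n (e2 m k γ i j) (-1) (Xd γ i (Xd γ j (rho γ)) : E m k → ℝ) := by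
  have h := KK_X1 (m := m) (k := k) hγ (n + 1) j
  obtain ⟨-, -, h3, h4⟩ := h
  induction i using Fin.addCases with
  | left i =>
    refine (KK.mono hγ (h3 i) ?_).cast rfl (by ring)
    unfold e1 e2
    by_cases hj : (j : ℕ) < m <;> simp [hj]
  | right i =>
    refine (KK.mono hγ (h4 i) ?_).cast rfl (by ring)
    unfold e1 e2
    by_cases hj : (j : ℕ) < m <;> simp [hj] <;> linarith

lemma Bd_X3 {γ : ℝ} (hγ : 0 < γ) (r i j : Fin (m + k)) :
    Bd γ (e2 m k γ i j + ed m k γ r) (-2)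
      (Xd γ r (Xd γ i (Xd γ j (rho γ))) : E m k → ℝ) := by
  obtain ⟨-, -, h3, h4⟩ := KK_X2 (m := m) (k := k) hγ 1 i j
  induction r using Fin.addCases with
  | left r =>
    exact ((h3 r).cast (by simp [ed]; ring) (by ring)).bd
  | right r =>
    exact ((h4 r).cast (by simp [ed]) (by ring)).bd

/-- A uniform constant for all first, second and third derivatives. -/
lemma uniform {γ : ℝ} (hγ : 0 < γ) : ∃ C : ℝ, 0 ≤ C ∧ ∀ p : E m k, p.1 ≠ 0 →
    (∀ i, |Xd γ i (rho γ) p| ≤ C * sg γ p ^ e1 m k γ i) ∧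
    (∀ i j, |Xd γ i (Xd γ j (rho γ)) p| ≤ C * (sg γ p ^ e2 m k γ i j * (rho γ p)⁻¹)) ∧
    (∀ r i j, |Xd γ r (Xd γ i (Xd γ j (rho γ))) p| ≤
      C * (sg γ p ^ (e2 m k γ i j + ed m k γ r) * (rho γ p ^ 2)⁻¹)) := by
  choose C1 hC1 h1 using fun i => (KK_X1 (m := m) (k := k) hγ 0 i).bd
  choose C2 hC2 h2 using fun i j => (KK_X2 (m := m) (k := k) hγ 0 i j).bd
  choose C3 hC3 h3 using fun r i j => Bd_X3 (m := m) (k := k) hγ r i j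
  have hs1 : 0 ≤ ∑ i, C1 i := Finset.sum_nonneg fun i _ => hC1 i
  have hs2 : 0 ≤ ∑ q : _ × _, C2 q.1 q.2 := Finset.sum_nonneg fun q _ => hC2 _ _
  have hs3 : 0 ≤ ∑ q : _ × _ × _, C3 q.1 q.2.1 q.2.2 := Finset.sum_nonneg fun q _ => hC3 _ _ _
  refine ⟨(∑ i, C1 i) + (∑ q : _ × _, C2 q.1 q.2) + ∑ q : _ × _ × _, C3 q.1 q.2.1 q.2.2,
    by positivity, fun p hp => ?_⟩
  have hσ := sg_pos γ hp
  have hr := rho_pos γ hp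
  refine ⟨fun i => ?_, fun i j => ?_, fun r i j => ?_⟩
  · have := h1 i p hp
    rw [Real.rpow_zero, mul_one] at this
    refine this.trans ?_
    gcongr
    have := Finset.single_le_sum (fun i _ => hC1 i) (Finset.mem_univ i)
    linarith
  · have := h2 i j p hp
    rw [Real.rpow_neg_one] at this
    refine this.trans ?_
    gcongr
    have := Finset.single_le_sum (f := fun q : _ × _ => C2 q.1 q.2)
      (fun q _ => hC2 q.1 q.2) (Finset.mem_univ (i, j))
    simp only at this
    linarith
  · have := h3 r i j p hp
    rw [Real.rpow_neg hr.le, Real.rpow_two] at this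
    refine this.trans ?_
    gcongr
    have := Finset.single_le_sum (f := fun q : _ × _ × _ => C3 q.1 q.2.1 q.2.2)
      (fun q _ => hC3 q.1 q.2.1 q.2.2) (Finset.mem_univ (r, i, j))
    simp only at this
    linarith

end BG
namespace BG

variable {m k : ℕ}

lemma Xd_sum {γ : ℝ} (hγ : 0 < γ) {A : E m k → Matrix (Fin (m + k)) (Fin (m + k)) ℝ}
    (hA : C1coeff A) (r : Fin (m + k)) {p : E m k} (hp : p.1 ≠ 0) :
    Xd γ r (fun x => ∑ i, ∑ j, (A x - 1) i j * Xd γ i (Xd γ j (rho γ)) x) p =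
      ∑ i, ∑ j, (Xd γ r (fun q => (A q - 1) i j) p * Xd γ i (Xd γ j (rho γ)) p +
        (A p - 1) i j * Xd γ r (Xd γ i (Xd γ j (rho γ))) p) := by
  have hb : ∀ i j, DifferentiableAt ℝ (fun q => (A q - 1) i j) p := fun i j => by
    simp only [Matrix.sub_apply]
    exact ((hA i j).differentiable one_ne_zero p).sub_const _
  have hG : ∀ i j, DifferentiableAt ℝ (Xd γ i (Xd γ j (rho γ)) : E m k → ℝ) p := fun i j =>
    (KK_X2 (m := m) (k := k) hγ 1 i j).2.1 p hp
  have h : HasFDerivAt (fun x => ∑ i, ∑ j, (A x - 1) i j * Xd γ i (Xd γ j (rho γ)) x)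
      (∑ i, ∑ j, ((A p - 1) i j • fderiv ℝ (Xd γ i (Xd γ j (rho γ))) p +
        Xd γ i (Xd γ j (rho γ)) p • fderiv ℝ (fun q => (A q - 1) i j) p)) p := by
    refine HasFDerivAt.fun_sum fun i _ => HasFDerivAt.fun_sum fun j _ => ?_
    exact (hb i j).hasFDerivAt.mul (hG i j).hasFDerivAt
  have hX : ∀ f : E m k → ℝ, Xd γ r f p = fderiv ℝ f p (Xvec γ p r) := fun _ => rfl
  rw [hX, h.fderiv]
  simp only [ContinuousLinearMap.sum_apply, ContinuousLinearMap.add_apply,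
    ContinuousLinearMap.smul_apply, smul_eq_mul]
  refine Finset.sum_congr rfl fun i _ => Finset.sum_congr rfl fun j _ => ?_
  rw [hX (fun q => (A q - 1) i j), hX (Xd γ i (Xd γ j (rho γ)))]
  ring

/-- Exponent in the bound for b. -/
def eb (m k : ℕ) (γ : ℝ) (i j : Fin (m + k)) : ℝ :=
  if (i : ℕ) < m ∧ (j : ℕ) < m then 0 else γ + 1

/-- Exponent in the bound for the derivatives of b. -/
def ec (m k : ℕ) (γ : ℝ) (l i j : Fin (m + k)) : ℝ :=
  if (l : ℕ) < m ∧ (i : ℕ) < m ∧ (j : ℕ) < m then 0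
  else if m ≤ (l : ℕ) ∧ (m ≤ (i : ℕ) ∨ m ≤ (j : ℕ)) then 2 * γ + 1 else γ

lemma eb_nonneg {γ : ℝ} (hγ : 0 < γ) (i j : Fin (m + k)) : 0 ≤ eb m k γ i j := by
  unfold eb; split_ifs <;> linarith

lemma exp1 {γ : ℝ} (hγ : 0 < γ) (i j : Fin (m + k)) :
    e1 m k γ j ≤ eb m k γ i j + e1 m k γ i := by
  unfold eb e1
  by_cases hi : (i : ℕ) < m <;> by_cases hj : (j : ℕ) < m <;> simp [hi, hj] <;> linarith

lemma exp2 {γ : ℝ} (hγ : 0 < γ) (r i j : Fin (m + k)) :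
    4 * γ ≤ e1 m k γ r + (ec m k γ r i j + e2 m k γ i j) := by
  unfold ec e1 e2
  split_ifs <;> first | linarith | (exfalso; omega)

lemma exp3 {γ : ℝ} (r i j : Fin (m + k)) :
    4 * γ ≤ e1 m k γ r + (eb m k γ i j + (e2 m k γ i j + ed m k γ r)) := by
  unfold eb e1 e2 ed
  by_cases hi : (i : ℕ) < m <;> by_cases hj : (j : ℕ) < m <;> by_cases hr : (r : ℕ) < m <;>
    simp [hi, hj, hr] <;> linarith

lemma hyp_b {γ Λ : ℝ} (hγ : 0 < γ) {A : E m k → Matrix (Fin (m + k)) (Fin (m + k)) ℝ}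
    (hH : HypH γ Λ A) {p : E m k} (hb : p ∈ ball (m := m) (k := k) γ 1) (hp : p.1 ≠ 0)
    (i j : Fin (m + k)) : |(A p - 1) i j| ≤ Λ * rho γ p * sg γ p ^ eb m k γ i j := by
  have h := (hH p hb).1 i j
  rw [psi_rpow γ _ hp] at h
  have e : 2 * γ * (1 / 2 + 1 / (2 * γ)) = γ + 1 := by field_simp
  rw [e] at h
  unfold eb
  split_ifs at h ⊢
  · simpa using h
  · exact h.trans_eq (by ring)

lemma hyp_c {γ Λ : ℝ} (hγ : 0 < γ) {A : E m k → Matrix (Fin (m + k)) (Fin (m + k)) ℝ}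
    (hH : HypH γ Λ A) {p : E m k} (hb : p ∈ ball (m := m) (k := k) γ 1) (hp : p.1 ≠ 0)
    (l i j : Fin (m + k)) :
    |Xd γ l (fun q => (A q - 1) i j) p| ≤ Λ * sg γ p ^ ec m k γ l i j := by
  have h := (hH p hb).2 l i j
  rw [psi_rpow γ _ hp, psi_rpow γ _ hp] at h
  have e : 2 * γ * (1 + 1 / (2 * γ)) = 2 * γ + 1 := by field_simp
  have e' : 2 * γ * (1 / 2) = γ := by ring
  rw [e, e'] at h
  unfold ec
  split_ifs at h ⊢
  · simpa using h
  · exact h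
  · exact h

/-- The pointwise bound. -/
lemma main_bound {γ Λ lam C : ℝ} (hγ : 0 < γ) (hΛ : 0 < Λ) (hlam : 0 < lam) (hC : 0 ≤ C)
    {A : E m k → Matrix (Fin (m + k)) (Fin (m + k)) ℝ}
    (hA : C1coeff A) (hE : Elliptic lam A) (hH : HypH γ Λ A) {p : E m k}
    (hb : p ∈ ball (m := m) (k := k) γ 1) (hp : p.1 ≠ 0)
    (hX1 : ∀ i, |Xd γ i (rho γ) p| ≤ C * sg γ p ^ e1 m k γ i)
    (hX2 : ∀ i j, |Xd γ i (Xd γ j (rho γ)) p| ≤ C * (sg γ p ^ e2 m k γ i j * (rho γ p)⁻¹))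
    (hX3 : ∀ r i j, |Xd γ r (Xd γ i (Xd γ j (rho γ))) p| ≤
      C * (sg γ p ^ (e2 m k γ i j + ed m k γ r) * (rho γ p ^ 2)⁻¹)) :
    |Fop γ A (fun x => ∑ i, ∑ j, (A x - 1) i j * Xd γ i (Xd γ j (rho γ)) x) p| ≤
      (((m + k : ℕ) : ℝ) ^ 2 * ((1 + Λ) * C) * (((m + k : ℕ) : ℝ) ^ 2 * (2 * Λ * C)) / lam)
        * psi γ p := by
  set v : E m k → ℝ := fun x => ∑ i, ∑ j, (A x - 1) i j * Xd γ i (Xd γ j (rho γ)) x with hv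
  set N : ℝ := ((m + k : ℕ) : ℝ) with hN
  have hσ := sg_pos γ hp
  have hσ1 := sg_le hγ hp
  have hr := rho_pos γ hp
  have hr1 : rho γ p < 1 := hb
  set σ := sg γ p with hσd
  set R := rho γ p with hR
  have pw : ∀ {a b : ℝ}, a ≤ b → σ ^ b ≤ σ ^ a := fun h =>
    Real.rpow_le_rpow_of_exponent_ge hσ hσ1 h
  have sum2 : ∀ (f : Fin (m + k) → Fin (m + k) → ℝ) (M : ℝ), (∀ i j, |f i j| ≤ M) →
      |∑ i, ∑ j, f i j| ≤ N ^ 2 * M := by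
    intro f M hf
    calc |∑ i, ∑ j, f i j| ≤ ∑ i : Fin (m + k), ∑ j : Fin (m + k), M :=
          (Finset.abs_sum_le_sum_abs _ _).trans (Finset.sum_le_sum fun i _ =>
            (Finset.abs_sum_le_sum_abs _ _).trans (Finset.sum_le_sum fun j _ => hf i j))
      _ = N ^ 2 * M := by simp [hN]; ring
  -- bound for A Xρ
  have hY : ∀ i j, |A p i j * Xd γ i (rho γ) p| ≤ (1 + Λ) * C * σ ^ e1 m k γ j := by
    intro i j
    have hB := hyp_b hγ hH hb hp i j
    have e : A p i j = (1 : Matrix (Fin (m + k)) (Fin (m + k)) ℝ) i j + (A p - 1) i j := by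
      simp [Matrix.sub_apply]
    rw [e, add_mul]
    refine (abs_add_le _ _).trans ?_
    have t1 : |(1 : Matrix (Fin (m + k)) (Fin (m + k)) ℝ) i j * Xd γ i (rho γ) p| ≤
        C * σ ^ e1 m k γ j := by
      by_cases hij : i = j
      · subst hij; simpa using hX1 i
      · rw [Matrix.one_apply_ne hij]; simp; positivity
    have t2 : |(A p - 1) i j * Xd γ i (rho γ) p| ≤ Λ * C * σ ^ e1 m k γ j := by
      rw [abs_mul]
      calc _ ≤ (Λ * R * σ ^ eb m k γ i j) * (C * σ ^ e1 m k γ i) :=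
            mul_le_mul hB (hX1 i) (abs_nonneg _) (by positivity)
        _ ≤ (Λ * 1 * σ ^ eb m k γ i j) * (C * σ ^ e1 m k γ i) := by gcongr
        _ = Λ * C * σ ^ (eb m k γ i j + e1 m k γ i) := by rw [Real.rpow_add hσ]; ring
        _ ≤ _ := by
          have := pw (exp1 hγ i j)
          gcongr
    linarith
  -- bound for σ^e X v
  have hD : ∀ r, |σ ^ e1 m k γ r * Xd γ r v p| ≤ N ^ 2 * (2 * Λ * C * (σ ^ (4 * γ) * R⁻¹)) := by
    intro r
    rw [hv, Xd_sum hγ hA r hp, Finset.mul_sum]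
    simp only [Finset.mul_sum]
    refine sum2 _ _ fun i j => ?_
    rw [abs_mul, abs_of_pos (Real.rpow_pos_of_pos hσ _)]
    have t1 : |Xd γ r (fun q => (A q - 1) i j) p * Xd γ i (Xd γ j (rho γ)) p| ≤
        Λ * C * R⁻¹ * σ ^ (ec m k γ r i j + e2 m k γ i j) := by
      rw [abs_mul, Real.rpow_add hσ]
      refine (mul_le_mul (hyp_c hγ hH hb hp r i j) (hX2 i j) (abs_nonneg _)
        (by positivity)).trans_eq ?_
      ring
    have t2 : |(A p - 1) i j * Xd γ r (Xd γ i (Xd γ j (rho γ))) p| ≤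
        Λ * C * R⁻¹ * σ ^ (eb m k γ i j + (e2 m k γ i j + ed m k γ r)) := by
      rw [abs_mul, Real.rpow_add hσ]
      refine (mul_le_mul (hyp_b hγ hH hb hp i j) (hX3 r i j) (abs_nonneg _)
        (by positivity)).trans_eq ?_
      rw [← hσd, ← hR]
      field_simp
    have p1 := pw (exp2 hγ r i j)
    have p2 := pw (exp3 (γ := γ) r i j)
    rw [Real.rpow_add hσ] at p1 p2
    calc _ ≤ σ ^ e1 m k γ r * (Λ * C * R⁻¹ * σ ^ (ec m k γ r i j + e2 m k γ i j) +
          Λ * C * R⁻¹ * σ ^ (eb m k γ i j + (e2 m k γ i j + ed m k γ r))) := by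
          gcongr
          exact (abs_add_le _ _).trans (add_le_add t1 t2)
      _ = Λ * C * R⁻¹ * (σ ^ e1 m k γ r * σ ^ (ec m k γ r i j + e2 m k γ i j)) +
          Λ * C * R⁻¹ * (σ ^ e1 m k γ r * σ ^ (eb m k γ i j + (e2 m k γ i j + ed m k γ r))) := by
          ring
      _ ≤ Λ * C * R⁻¹ * σ ^ (4 * γ) + Λ * C * R⁻¹ * σ ^ (4 * γ) := by gcongr
      _ = _ := by ring
  have hT : |∑ i, ∑ j, A p i j * Xd γ i (rho γ) p * Xd γ j v p| ≤
      N ^ 2 * ((1 + Λ) * C * (N ^ 2 * (2 * Λ * C * (σ ^ (4 * γ) * R⁻¹)))) := by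
    refine sum2 _ _ fun i j => ?_
    have hDj := hD j
    rw [abs_mul, abs_of_pos (Real.rpow_pos_of_pos hσ _)] at hDj
    rw [abs_mul]
    calc _ ≤ (1 + Λ) * C * σ ^ e1 m k γ j * |Xd γ j v p| := by
          gcongr; exact hY i j
      _ = (1 + Λ) * C * (σ ^ e1 m k γ j * |Xd γ j v p|) := by ring
      _ ≤ _ := by gcongr
  have hψ : psi γ p = σ ^ (2 * γ) := psi_eq γ hp
  have hψ0 : 0 < psi γ p := by rw [hψ]; positivity
  have hψ2 : σ ^ (4 * γ) = psi γ p * psi γ p := by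
    rw [hψ, ← Real.rpow_add hσ]; congr 1; ring
  have hμ : lam * psi γ p ≤ mu γ A p := by
    have := (hE p fun i => Xd γ i (rho γ) p).1
    rw [sum_sq_rho hγ hp] at this
    exact this
  have hμ0 : 0 < mu γ A p := lt_of_lt_of_le (by positivity) hμ
  unfold Fop
  rw [abs_mul, abs_of_pos (div_pos hr hμ0)]
  calc _ ≤ R / (lam * psi γ p) *
        (N ^ 2 * ((1 + Λ) * C * (N ^ 2 * (2 * Λ * C * (σ ^ (4 * γ) * R⁻¹))))) := by
        gcongr
    _ = _ := by rw [hψ2]; field_simp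

end BG

open BG in
/-- the third derivative estimate |F(b_{ij} X_i X_j ρ)| ≤ C ψ
(Lemma `lma3.3` of the paper). -/
theorem third_derivative_estimate
    (m k : ℕ) (hm : 1 ≤ m) (hk : 1 ≤ k) (γ : ℝ) (hγ : 0 < γ)
    (lam Λ : ℝ) (hlam : 0 < lam) (hΛ : 0 < Λ) :
    ∃ C > (0 : ℝ),
      ∀ A : E m k → Matrix (Fin (m + k)) (Fin (m + k)) ℝ,
        C1coeff A → Symm A → Elliptic lam A → A 0 = 1 → HypH γ Λ A →
        ∀ p ∈ ball (m := m) (k := k) γ 1, p.1 ≠ 0 →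
          |Fop γ A
              (fun x => ∑ i, ∑ j, (A x - 1) i j * Xd γ i (Xd γ j (rho γ)) x) p|
            ≤ C * psi γ p := by
  obtain ⟨C, hC, h⟩ := uniform (m := m) (k := k) hγ
  refine ⟨((m + k : ℕ) : ℝ) ^ 2 * ((1 + Λ) * C) * (((m + k : ℕ) : ℝ) ^ 2 * (2 * Λ * C)) / lam + 1,
    by positivity, ?_⟩
  intro A hA _ hE _ hH p hb hp
  obtain ⟨h1, h2, h3⟩ := h p hp
  refine (main_bound hγ hΛ hlam hC hA hE hH hb hp h1 h2 h3).trans ?_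
  have hψ0 : 0 ≤ psi γ p := by
    rw [psi_eq γ hp]; exact (Real.rpow_pos_of_pos (sg_pos γ hp) _).le
  rw [add_mul, one_mul]
  linarith
end
end

section
/- Let v be a C¹ function on an open subset of ℝ^m × ℝ^k. Then at every point of its domain with z ≠ 0 one has ⟨Xv, Xρ⟩ = Σ_{i=1}^N X_i v · X_i ρ = (ψ/ρ) Zv, where Z = Σ_{i=1}^m z_i ∂_{z_i} + (γ+1) Σ_{j=1}^k t_j ∂_{t_j}. -/
open MeasureTheory Real Set Filter Asymptotics

noncomputable section

namespace BG

/-- The derivative of the gauge at points with z ≠ 0. -/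
lemma fderiv_rho_apply {m k : ℕ} (γ : ℝ) (hγ : 0 < γ) (p : E m k) (hz : p.1 ≠ 0) (w : E m k) :
    fderiv ℝ (rho γ) p w = psi γ p / rho γ p / ‖p.1‖ ^ (2 * γ) *
      (‖p.1‖ ^ (2 * γ) * inner ℝ p.1 w.1 + (γ + 1) * inner ℝ p.2 w.2) := by
  have hn : 0 < ‖p.1‖ := norm_pos_iff.mpr hz
  have key : ∀ x : ℝ, 0 ≤ x → ∀ y : ℝ, x ^ (2 * y) = (x ^ 2) ^ y := by
    intro x hx y
    rw [Real.rpow_mul hx, Real.rpow_two]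
  have h1 : HasFDerivAt (fun q : E m k => ‖q.1‖ ^ 2)
      (2 • (innerSL ℝ p.1).comp (ContinuousLinearMap.fst ℝ _ _)) p :=
    (hasFDerivAt_fst (𝕜 := ℝ) (p := p)).norm_sq
  have h2 : HasFDerivAt (fun q : E m k => ‖q.2‖ ^ 2)
      (2 • (innerSL ℝ p.2).comp (ContinuousLinearMap.snd ℝ _ _)) p :=
    (hasFDerivAt_snd (𝕜 := ℝ) (p := p)).norm_sq
  have hS : 0 < (‖p.1‖ ^ 2) ^ (γ + 1) + (γ + 1) ^ 2 * ‖p.2‖ ^ 2 := by positivity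
  have h3 := ((h1.rpow_const (p := γ + 1) (Or.inl (by positivity))).add
    (h2.const_mul ((γ + 1) ^ 2))).rpow_const (p := 1 / (2 * (γ + 1))) (Or.inl hS.ne')
  have heq : (rho γ : E m k → ℝ) = fun q =>
      ((‖q.1‖ ^ 2) ^ (γ + 1) + (γ + 1) ^ 2 * ‖q.2‖ ^ 2) ^ (1 / (2 * (γ + 1))) := by
    funext q
    rw [rho, key _ (norm_nonneg _)]
  have hpow : psi γ p / rho γ p / ‖p.1‖ ^ (2 * γ) =
      ((‖p.1‖ ^ 2) ^ (γ + 1) + (γ + 1) ^ 2 * ‖p.2‖ ^ 2) ^ (1 / (2 * (γ + 1)) - 1) := by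
    rw [psi, heq]
    dsimp only
    generalize (‖p.1‖ ^ 2) ^ (γ + 1) + (γ + 1) ^ 2 * ‖p.2‖ ^ 2 = S at hS
    have e : 1 / (2 * (γ + 1)) - 1 =
        -(1 / (2 * (γ + 1)) * (2 * γ) + 1 / (2 * (γ + 1))) := by
      field_simp
      ring
    rw [e, Real.rpow_neg hS.le, Real.rpow_add hS, ← Real.rpow_mul hS.le]
    have : 0 < ‖p.1‖ ^ (2 * γ) := by positivity
    field_simp
  rw [hpow]
  have h4 := h3.fderiv
  simp only [Pi.add_apply] at h4
  rw [heq, h4, key _ hn.le]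
  simp only [Pi.add_apply, ContinuousLinearMap.smul_apply, ContinuousLinearMap.add_apply,
    ContinuousLinearMap.comp_apply, ContinuousLinearMap.coe_fst', ContinuousLinearMap.coe_snd',
    innerSL_apply_apply, smul_eq_mul, nsmul_eq_mul, add_sub_cancel_right]
  push_cast
  field_simp

end BG

open BG in
/-- the identity ⟨Xv, Xρ⟩ = (ψ/ρ) Zv
(identity (2.12) of the paper). -/
theorem Xv_dot_Xrho
    (m k : ℕ) (hm : 1 ≤ m) (hk : 1 ≤ k) (γ : ℝ) (hγ : 0 < γ)
    (U : Set (E m k)) (hU : IsOpen U) (v : E m k → ℝ)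
    (hv : ContDiffOn ℝ 1 v U) (p : E m k) (hp : p ∈ U) (hz : p.1 ≠ 0) :
    ∑ i : Fin (m + k), Xd γ i v p * Xd γ i (rho γ) p
      = psi γ p / rho γ p * Zd γ v p := by
  rw [Fin.sum_univ_add]
  have hn : 0 < ‖p.1‖ := norm_pos_iff.mpr hz
  have hn2 : 0 < ‖p.1‖ ^ (2 * γ) := by positivity
  have hsq : ‖p.1‖ ^ (2 * γ) = ‖p.1‖ ^ γ * ‖p.1‖ ^ γ := by
    rw [← Real.rpow_add hn, two_mul]
  have hX1 : ∀ i : Fin m, Xvec γ p (Fin.castAdd k i) = (EuclideanSpace.single i 1, 0) := by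
    intro i
    simp [Xvec]
  have hX2 : ∀ j : Fin k, Xvec γ p (Fin.natAdd m j) =
      (0, EuclideanSpace.single j (‖p.1‖ ^ γ)) := by
    intro j
    simp [Xvec]
  have hX3 : ∀ j : Fin k, ((0, EuclideanSpace.single j (‖p.1‖ ^ γ)) : E m k) =
      ‖p.1‖ ^ γ • ((0, EuclideanSpace.single j 1) : E m k) := by
    intro j
    ext i <;> simp
  have hZ : ((p.1, (γ + 1) • p.2) : E m k) =
      ∑ i, p.1 i • ((EuclideanSpace.single i 1, 0) : E m k) +
        (γ + 1) • ∑ j, p.2 j • ((0, EuclideanSpace.single j 1) : E m k) := by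
    ext i
    · simp [Prod.fst_sum, Pi.single_apply]
    · simp [Prod.snd_sum, Pi.single_apply]
  simp only [Zd, Xd, hX1, hX2, fderiv_rho_apply γ hγ p hz]
  rw [hZ]
  simp only [hX3, map_add, map_sum, map_smul, smul_eq_mul, Finset.mul_sum, mul_add]
  congr 1
  · refine Finset.sum_congr rfl fun i _ => ?_
    simp [EuclideanSpace.inner_single_right]
    field_simp
  · refine Finset.sum_congr rfl fun j _ => ?_
    simp [EuclideanSpace.inner_single_right]
    rw [hsq]
    field_simp
end
end
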